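/- Assume P has real coefficients with P(k) > 0 for every natural number k. For every natural number p, the polynomial zeta function ζ^{(p)}_P admits a holomorphic continuation to 0: there exist an open connected set U ⊆ ℂ containing 0 and the half-plane {s : Re s > p + 1}, and a holomorphic function Z : U → ℂ with Z(s) = Σ_{k=0}^∞ k^p P(k)^{−s} whenever Re s > p + 1. -/

import Mathlib

/-- The polynomial `P(x) = aₙ xⁿ + ⋯ + a₁ x + a₀` evaluated at a real point. -/
noncomputable def Pval (n : ℕ) (a : ℕ → ℝ) (x : ℝ) : ℝ :=
  ∑ i ∈ Finset.range (n + 1), a i * x ^ i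

open Filter Topology Asymptotics

/-- Taylor polynomials of analytic functions of one real variable. -/
theorem AnalyticAt.exists_taylor_isBigO {f : ℝ → ℝ} (hf : AnalyticAt ℝ f 0) (N : ℕ) :
    ∃ d : ℕ → ℝ, (fun x : ℝ => f x - ∑ j ∈ Finset.range N, d j * x ^ j) =O[𝓝 0]
      fun x => x ^ N := by
  obtain ⟨q, hq⟩ := hf
  refine ⟨q.coeff, ?_⟩
  refine ((hq.isBigO_sub_partialSum_pow N).congr_left fun x => ?_).trans ?_
  · simp [FormalMultilinearSeries.partialSum, mul_comm]
  · exact IsBigO.of_bound 1 (Eventually.of_forall fun x => by simp)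

/-- If `w` is analytic with `w 0 = 0`, then `exp (-s w(x)) - 1` has an expansion in powers of `x`,
locally uniform in `s`, all of whose coefficients are entire multiples of `s`. -/
theorem exists_exp_neg_mul_expansion {w : ℝ → ℝ} (hw : AnalyticAt ℝ w 0) (hw0 : w 0 = 0) (M : ℕ) :
    ∃ b : ℕ → ℂ → ℂ, (∀ j, Differentiable ℂ (b j)) ∧ ∀ S : ℝ,
      (fun q : ℝ × ℂ => Complex.exp (-q.2 * w q.1) - 1
          - ∑ j ∈ Finset.range (M + 1), q.2 * b j q.2 * (q.1 : ℂ) ^ j)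
        =O[𝓝 0 ×ˢ 𝓟 (Metric.closedBall 0 S)] fun q => (q.1 : ℂ) ^ (M + 1) := by
  choose d hd using fun m : ℕ => (hw.pow m).exists_taylor_isBigO (M + 1)
  refine ⟨fun j s => ∑ m ∈ Finset.range M,
    -(-s) ^ m / ((m + 1).factorial : ℂ) * d (m + 1) j, fun j => by fun_prop, fun S => ?_⟩
  set l : Filter (ℝ × ℂ) := 𝓝 0 ×ˢ 𝓟 (Metric.closedBall 0 S)
  have hfst : Tendsto (fun q : ℝ × ℂ => q.1) l (𝓝 0) := tendsto_fst
  have hS : ∀ᶠ q in l, ‖q.2‖ ≤ S := by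
    filter_upwards [tendsto_snd.eventually (eventually_principal.2 fun x hx => hx)] with q hq
    simpa using hq
  have hsnd : (fun q : ℝ × ℂ => -q.2) =O[l] fun _ => (1 : ℝ) := by
    refine IsBigO.of_bound S ?_
    filter_upwards [hS] with q hq
    simpa using hq
  have hwO : (fun q : ℝ × ℂ => (w q.1 : ℂ)) =O[l] fun q => (q.1 : ℂ) := by
    have h := (hw.differentiableAt.isBigO_sub).comp_tendsto hfst
    simp only [Function.comp_def, hw0, sub_zero] at h
    refine IsBigO.of_norm_norm ?_
    simpa only [Complex.norm_real] using h.norm_norm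
  have hz : (fun q : ℝ × ℂ => -q.2 * (w q.1 : ℂ)) =O[l] fun q => (q.1 : ℂ) := by
    simpa using hsnd.mul (hwO.norm_right)
  have hfstC : Tendsto (fun q : ℝ × ℂ => (q.1 : ℂ)) l (𝓝 0) :=
    (Complex.continuous_ofReal.tendsto' 0 0 rfl).comp hfst
  have hexp := ((Complex.exp_sub_sum_range_isBigO_pow (M + 1)).comp_tendsto
    (hz.trans_tendsto hfstC)).trans (hz.pow (M + 1))
  have hpoly : (fun q : ℝ × ℂ => ∑ m ∈ Finset.range M, (-q.2) ^ (m + 1) *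
      (((m + 1).factorial : ℂ)⁻¹ * ((w q.1 ^ (m + 1)
        - ∑ j ∈ Finset.range (M + 1), d (m + 1) j * q.1 ^ j : ℝ) : ℂ)))
      =O[l] fun q => (q.1 : ℂ) ^ (M + 1) := by
    refine IsBigO.fun_sum fun m _ => ?_
    have h := (hd (m + 1)).comp_tendsto hfst
    have h' : (fun q : ℝ × ℂ => ((w q.1 ^ (m + 1)
        - ∑ j ∈ Finset.range (M + 1), d (m + 1) j * q.1 ^ j : ℝ) : ℂ))
        =O[l] fun q => (q.1 : ℂ) ^ (M + 1) := by
      refine IsBigO.of_norm_norm ?_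
      simpa only [Complex.norm_real, norm_pow, Function.comp_def, Pi.pow_apply] using h.norm_norm
    refine IsBigO.of_norm_right ?_
    simpa using (hsnd.pow (m + 1)).mul ((h'.const_mul_left ((m + 1).factorial : ℂ)⁻¹).norm_right)
  refine (hexp.add hpoly).congr_left fun q => ?_
  simp only [Function.comp_def]
  rw [Finset.sum_range_succ']
  have h1 : ∑ j ∈ Finset.range (M + 1), q.2 * (∑ m ∈ Finset.range M,
      -(-q.2) ^ m / ((m + 1).factorial : ℂ) * d (m + 1) j) * (q.1 : ℂ) ^ j
      = ∑ m ∈ Finset.range M, (-q.2) ^ (m + 1) * (((m + 1).factorial : ℂ)⁻¹ *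
        ∑ j ∈ Finset.range (M + 1), d (m + 1) j * (q.1 : ℂ) ^ j) := by
    simp only [Finset.mul_sum, Finset.sum_mul]
    rw [Finset.sum_comm]
    refine Finset.sum_congr rfl fun m _ => Finset.sum_congr rfl fun j _ => ?_
    rw [pow_succ]
    ring
  rw [h1]
  push_cast
  simp only [mul_sub, Finset.sum_sub_distrib, mul_pow, pow_zero, Nat.factorial_zero]
  have h2 : ∑ m ∈ Finset.range M, (-q.2) ^ (m + 1) * (w q.1 : ℂ) ^ (m + 1)
        / ((m + 1).factorial : ℂ)
      = ∑ m ∈ Finset.range M, (-q.2) ^ (m + 1) *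
        (((m + 1).factorial : ℂ)⁻¹ * (w q.1 : ℂ) ^ (m + 1)) :=
    Finset.sum_congr rfl fun m _ => by ring
  rw [h2]
  push_cast
  ring

/-- Weierstrass test for series of holomorphic functions whose terms are eventually dominated. -/
theorem differentiableOn_tsum_of_eventually_norm_le {F : ℕ → ℂ → ℂ} {U : Set ℂ} {u : ℕ → ℝ}
    (hu : Summable u) (hU : IsOpen U) (hF : ∀ k, DifferentiableOn ℂ (F k) U)
    (hle : ∀ᶠ k in atTop, ∀ s ∈ U, ‖F k s‖ ≤ u k) :
    DifferentiableOn ℂ (fun s => ∑' k, F k s) U := by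
  have h := tendstoUniformlyOn_tsum_of_cofinite_eventually hu (Nat.cofinite_eq_atTop ▸ hle)
  exact h.tendstoLocallyUniformlyOn.differentiableOn
    (Eventually.of_forall fun t => DifferentiableOn.fun_sum fun k _ => hF k) hU

theorem norm_one_div_nat_add_one_cpow (k : ℕ) (z : ℂ) :
    ‖1 / ((k : ℂ) + 1) ^ z‖ = ((k : ℝ) + 1) ^ (-z.re) := by
  have h : (0 : ℝ) < (k : ℝ) + 1 := by positivity
  have h' := Complex.norm_cpow_eq_rpow_re_of_pos h z
  push_cast at h'
  rw [norm_div, norm_one, h', Real.rpow_neg h.le, one_div]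

theorem summable_nat_add_one_rpow_neg {r : ℝ} (hr : 1 < r) :
    Summable fun k : ℕ => ((k : ℝ) + 1) ^ (-r) := by
  simpa using (summable_nat_add_iff (f := fun k : ℕ => (k : ℝ) ^ (-r)) 1).2
    (Real.summable_nat_rpow.2 (by linarith))

theorem hasSum_riemannZeta_nat_add_one {z : ℂ} (hz : 1 < z.re) :
    HasSum (fun k : ℕ => 1 / ((k : ℂ) + 1) ^ z) (riemannZeta z) := by
  rw [zeta_eq_tsum_one_div_nat_add_one_cpow hz]
  refine Summable.hasSum (Summable.of_norm ?_)
  simpa only [norm_one_div_nat_add_one_cpow] using summable_nat_add_one_rpow_neg hz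

/-- A Dirichlet-type series whose coefficients are `O(k ^ -(p + 2))`, locally uniformly in `s`, after
the factor `k ^ (p - n s)` is taken out, is summable and holomorphic on a neighbourhood of
`{s | 0 ≤ re s}`. -/
theorem summable_and_differentiableOn_tsum_remainder {n : ℕ} (hn : 1 ≤ n) (p : ℕ)
    {B : ℝ → ℂ → ℂ} (hB : ∀ x, Differentiable ℂ (B x))
    (hO : ∀ S : ℝ, (fun q : ℝ × ℂ => B q.1 q.2) =O[𝓝 0 ×ˢ 𝓟 (Metric.closedBall 0 S)]
      fun q => (q.1 : ℂ) ^ (p + 2)) :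
    (∀ s : ℂ, -(1 / (2 * n) : ℝ) < s.re →
      Summable fun k : ℕ => 1 / ((k : ℂ) + 1) ^ (n * s - p : ℂ) * B (1 / ((k : ℝ) + 1)) s) ∧
    DifferentiableOn ℂ (fun s : ℂ => ∑' k : ℕ,
      1 / ((k : ℂ) + 1) ^ (n * s - p : ℂ) * B (1 / ((k : ℝ) + 1)) s)
      {s | -(1 / (2 * n) : ℝ) < s.re} := by
  have hn' : (0 : ℝ) < n := by exact_mod_cast hn
  have key : ∀ S : ℝ, ∃ u : ℕ → ℝ, Summable u ∧ ∀ᶠ k : ℕ in atTop, ∀ s : ℂ,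
      -(1 / (2 * n) : ℝ) < s.re → ‖s‖ ≤ S →
        ‖1 / ((k : ℂ) + 1) ^ (n * s - p : ℂ) * B (1 / ((k : ℝ) + 1)) s‖ ≤ u k := by
    intro S
    obtain ⟨C, hC⟩ := (hO S).bound
    rw [eventually_prod_principal_iff] at hC
    refine ⟨fun k => |C| * ((k : ℝ) + 1) ^ (-(3 / 2 : ℝ)),
      (summable_nat_add_one_rpow_neg (by norm_num)).mul_left _, ?_⟩
    filter_upwards [tendsto_one_div_add_atTop_nhds_zero_nat.eventually hC] with k hk s hs hsS
    have h := hk s (by simpa using hsS)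
    have hk1 : (1 : ℝ) ≤ (k : ℝ) + 1 := by simp
    have hk0 : (0 : ℝ) < (k : ℝ) + 1 := by positivity
    rw [norm_mul, norm_one_div_nat_add_one_cpow]
    have hx : ‖((1 / ((k : ℝ) + 1) : ℝ) : ℂ) ^ (p + 2)‖ = ((k : ℝ) + 1) ^ (-((p : ℝ) + 2)) := by
      rw [norm_pow, Complex.norm_real, Real.norm_of_nonneg (by positivity), Real.rpow_neg hk0.le,
        one_div, inv_pow, ← Real.rpow_natCast]
      push_cast
      rfl
    have hns : -(1 / 2 : ℝ) < n * s.re := by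
      have := mul_lt_mul_of_pos_left hs hn'
      have h2 : (n : ℝ) * -(1 / (2 * n)) = -(1 / 2) := by field_simp
      linarith
    calc ((k : ℝ) + 1) ^ (-(n * s - p : ℂ).re) * ‖B (1 / ((k : ℝ) + 1)) s‖
        ≤ ((k : ℝ) + 1) ^ (-(n * s - p : ℂ).re) * (|C| * ((k : ℝ) + 1) ^ (-((p : ℝ) + 2))) := by
          rw [← hx]
          gcongr
          exact h.trans (by gcongr; exact le_abs_self C)
      _ = |C| * ((k : ℝ) + 1) ^ (-(n * s.re) - 2) := by
          rw [mul_left_comm, ← Real.rpow_add hk0]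
          congr 2
          simp
          ring
      _ ≤ |C| * ((k : ℝ) + 1) ^ (-(3 / 2 : ℝ)) := by
          refine mul_le_mul_of_nonneg_left ?_ (abs_nonneg C)
          exact Real.rpow_le_rpow_of_exponent_le hk1 (by linarith)
  constructor
  · intro s hs
    obtain ⟨u, hu, hk⟩ := key ‖s‖
    refine Summable.of_norm_bounded_eventually_nat hu ?_
    filter_upwards [hk] with k hk using hk s hs le_rfl
  · intro s hs
    obtain ⟨u, hu, hk⟩ := key (‖s‖ + 1)
    have hopen : IsOpen ({s : ℂ | -(1 / (2 * n) : ℝ) < s.re} ∩ {z | ‖z‖ < ‖s‖ + 1}) :=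
      (isOpen_lt continuous_const Complex.continuous_re).inter
        (isOpen_lt continuous_norm continuous_const)
    have h := differentiableOn_tsum_of_eventually_norm_le hu hopen
      (F := fun k s => 1 / ((k : ℂ) + 1) ^ (n * s - p : ℂ) * B (1 / ((k : ℝ) + 1)) s)
      (fun k => by
        have hk : (k : ℂ) + 1 ≠ 0 := by exact_mod_cast k.succ_ne_zero
        have hd : Differentiable ℂ fun s : ℂ => ((k : ℂ) + 1) ^ (n * s - p : ℂ) := by
          intro z
          exact DifferentiableAt.const_cpow (by fun_prop) (Or.inl hk)
        have hne : ∀ s : ℂ, ((k : ℂ) + 1) ^ (n * s - p : ℂ) ≠ 0 := fun s => by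
          simp [Complex.cpow_eq_zero_iff, hk]
        exact (((differentiable_const _).div hd hne).mul (hB _)).differentiableOn)
      (by filter_upwards [hk] with k hk z hz using hk z hz.1 hz.2.le)
    exact (h.differentiableAt (hopen.mem_nhds ⟨hs, by simp⟩)).differentiableWithinAt

/-- The union of a right half-plane, an quarter-plane and a vertical strip around `0`. -/
theorem isConnected_halfPlane_union {r c : ℝ} (hr : 0 < r) :
    IsConnected ({s : ℂ | c < s.re} ∪ {s | -r < s.re ∧ 0 < s.im} ∪ {s | -r < s.re ∧ s.re < r}) := by
  have hA : Convex ℝ {s : ℂ | c < s.re} := convex_halfSpace_re_gt c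
  have hB : Convex ℝ {s : ℂ | -r < s.re ∧ 0 < s.im} :=
    (convex_halfSpace_re_gt _).inter (convex_halfSpace_im_gt _)
  have hC : Convex ℝ {s : ℂ | -r < s.re ∧ s.re < r} :=
    (convex_halfSpace_re_gt _).inter (convex_halfSpace_re_lt _)
  refine ⟨⟨0, Or.inr (by simpa using hr)⟩, ?_⟩
  refine IsPreconnected.union Complex.I (Or.inr (by simpa using hr)) (by simpa using hr) ?_
    hC.isPreconnected
  refine IsPreconnected.union (⟨max c 0 + 1, 1⟩ : ℂ) ?_ ?_ hA.isPreconnected hB.isPreconnected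
  · have := le_max_left c 0
    simp only [Set.mem_ofPred_eq]
    linarith
  · have := le_max_right c 0
    simp only [Set.mem_ofPred_eq, zero_lt_one, and_true]
    linarith

theorem Pval_eq_pow_mul (n : ℕ) (a : ℕ → ℝ) {x : ℝ} (hx : x ≠ 0) :
    Pval n a x = x ^ n * ∑ i ∈ Finset.range (n + 1), a i * (1 / x) ^ (n - i) := by
  rw [Pval, Finset.mul_sum]
  refine Finset.sum_congr rfl fun i hi => ?_
  have hin : i ≤ n := by simpa [Nat.lt_succ_iff] using hi
  have : x ^ n = x ^ i * x ^ (n - i) := by rw [← pow_add, Nat.add_sub_cancel' hin]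
  have h1 : x ^ (n - i) * (1 / x) ^ (n - i) = 1 := by
    rw [← mul_pow, mul_one_div_cancel hx, one_pow]
  rw [this]
  linear_combination (-(a i * x ^ i)) * h1

theorem differentiableOn_mul_riemannZeta_shift {U : Set ℂ} {n p j : ℕ}
    (hU : ∀ s ∈ U, ∀ t : ℕ, 1 ≤ t → t ≤ p + 1 → (n : ℂ) * s ≠ t) (hj : j ≤ p) :
    DifferentiableOn ℂ (fun s => riemannZeta (n * s + j - p)) U := by
  intro s hs
  refine DifferentiableAt.differentiableWithinAt ?_
  refine DifferentiableAt.fun_comp' (g := riemannZeta) (f := fun s : ℂ => n * s + j - p) s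
    (differentiableAt_riemannZeta fun h => hU s hs (p + 1 - j) (by omega) (by omega) ?_)
    (by fun_prop)
  rw [Nat.cast_sub (by omega)]
  push_cast
  linear_combination h

theorem natCast_add_one_pow_mul_exp (n p k : ℕ) (s : ℂ) (y y₀ : ℝ) :
    ((k : ℂ) + 1) ^ p * Complex.exp (-s * ((n * Real.log ((k : ℝ) + 1) + y : ℝ) : ℂ))
      = Complex.exp (-s * y₀) *
        (1 / ((k : ℂ) + 1) ^ (n * s - p : ℂ) * Complex.exp (-s * ((y - y₀ : ℝ) : ℂ))) := by
  have hk : (k : ℂ) + 1 ≠ 0 := by exact_mod_cast k.succ_ne_zero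
  have hlog : Complex.log ((k : ℂ) + 1) = ((Real.log ((k : ℝ) + 1) : ℝ) : ℂ) := by
    rw [Complex.ofReal_log (by positivity)]
    push_cast
    rfl
  rw [Complex.cpow_sub _ _ hk, Complex.cpow_natCast, one_div_div, Complex.cpow_def_of_ne_zero hk,
    hlog, div_eq_mul_inv, ← Complex.exp_neg]
  have h : (-s * ((n * Real.log ((k : ℝ) + 1) + y : ℝ) : ℂ)) = -s * y₀
      + -((Real.log ((k : ℝ) + 1) : ℂ) * (n * s)) + -s * ((y - y₀ : ℝ) : ℂ) := by
    push_cast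
    ring
  rw [h, Complex.exp_add, Complex.exp_add]
  ring

theorem one_div_cpow_mul_one_div_pow (n p k j : ℕ) (s : ℂ) :
    1 / ((k : ℂ) + 1) ^ (n * s - p : ℂ) * ((1 / ((k : ℝ) + 1) : ℝ) : ℂ) ^ j
      = 1 / ((k : ℂ) + 1) ^ (n * s + j - p : ℂ) := by
  have hk : (k : ℂ) + 1 ≠ 0 := by exact_mod_cast k.succ_ne_zero
  rw [show (n * s + j - p : ℂ) = (n * s - p) + j by ring, Complex.cpow_add _ _ hk,
    Complex.cpow_natCast]
  push_cast
  rw [one_div_pow, ← one_div_mul_one_div]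

/-- The local behaviour at infinity of the values of a polynomial that is positive on `ℕ`: their
logarithm is `n log k` plus an analytic function of `1 / k`. -/
theorem exists_log_Pval_eq {n : ℕ} {a : ℕ → ℝ} (han : a n ≠ 0)
    (hpos : ∀ k : ℕ, 0 < Pval n a k) :
    ∃ L : ℝ → ℝ, AnalyticAt ℝ L 0 ∧ ∀ k : ℕ,
      Real.log (Pval n a ((k : ℝ) + 1)) = n * Real.log ((k : ℝ) + 1) + L (1 / ((k : ℝ) + 1)) := by
  set Q : ℝ → ℝ := fun x => ∑ i ∈ Finset.range (n + 1), a i * x ^ (n - i)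
  have hP : ∀ k : ℕ, Pval n a ((k : ℝ) + 1) = ((k : ℝ) + 1) ^ n * Q (1 / ((k : ℝ) + 1)) :=
    fun k => Pval_eq_pow_mul n a (by positivity)
  have hQpos : ∀ k : ℕ, 0 < Q (1 / ((k : ℝ) + 1)) := fun k => by
    have h := hpos (k + 1)
    push_cast at h
    rw [hP] at h
    exact pos_of_mul_pos_right h (by positivity)
  have hQ0 : Q 0 = a n := by
    simp only [Q, Finset.sum_range_succ, Nat.sub_self, pow_zero, mul_one, add_eq_right]
    refine Finset.sum_eq_zero fun i hi => ?_
    rw [zero_pow (by have := Finset.mem_range.1 hi; omega), mul_zero]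
  have hQc : Continuous Q := by fun_prop
  have hge : 0 ≤ Q 0 :=
    ge_of_tendsto' ((hQc.tendsto 0).comp tendsto_one_div_add_atTop_nhds_zero_nat)
      fun k => (hQpos k).le
  have hQa : AnalyticAt ℝ Q 0 := by fun_prop
  refine ⟨fun x => Real.log (Q x), hQa.log (lt_of_le_of_ne hge (hQ0 ▸ han.symm)), fun k => ?_⟩
  rw [hP, Real.log_mul (by positivity) (hQpos k).ne', Real.log_pow]

/-- Assuming `P(k) > 0` for every natural `k`, for every `p` the polynomial zeta function
`ζ^{(p)}_P(s) = Σ_{k=0}^∞ kᵖ P(k)^{−s}` admits a holomorphic continuation to `0`: there are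
an open connected `U ⊆ ℂ` containing `0` and the half-plane `{s : Re s > p + 1}` and a
holomorphic `Z : U → ℂ` agreeing with the series on that half-plane. -/
theorem polyZeta_holomorphic_continuation
    (n : ℕ) (hn : 1 ≤ n) (a : ℕ → ℝ) (han : a n ≠ 0) (ha0 : a 0 ≠ 0)
    (hpos : ∀ k : ℕ, 0 < Pval n a k)
    (p : ℕ) :
    ∃ U : Set ℂ, ∃ Z : ℂ → ℂ, IsOpen U ∧ IsConnected U ∧ (0 : ℂ) ∈ U ∧
      {s : ℂ | (p : ℝ) + 1 < s.re} ⊆ U ∧ DifferentiableOn ℂ Z U ∧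
      ∀ s : ℂ, (p : ℝ) + 1 < s.re →
        Z s = ∑' k : ℕ, (k : ℂ) ^ p * Complex.exp (-s * (Real.log (Pval n a k) : ℂ)) := by
  have hn0 : (0 : ℝ) < n := by exact_mod_cast hn
  have hnC : (n : ℂ) ≠ 0 := by exact_mod_cast hn0.ne'
  obtain ⟨L, hL, hlogP⟩ := exists_log_Pval_eq han hpos
  obtain ⟨b, hb, hO⟩ := exists_exp_neg_mul_expansion (w := fun x => L x - L 0)
    (hL.sub analyticAt_const) (by simp) (p + 1)
  set B : ℝ → ℂ → ℂ := fun x s => Complex.exp (-s * ((L x - L 0 : ℝ) : ℂ)) - 1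
    - ∑ j ∈ Finset.range (p + 1 + 1), s * b j s * (x : ℂ) ^ j with hBdef
  have hB : ∀ x, Differentiable ℂ (B x) := fun x => by fun_prop
  obtain ⟨hsum, hdiff⟩ := summable_and_differentiableOn_tsum_remainder hn p hB hO
  set R : ℂ → ℂ := fun s => ∑' k : ℕ,
    1 / ((k : ℂ) + 1) ^ (n * s - p : ℂ) * B (1 / ((k : ℝ) + 1)) s
  set r : ℝ := 1 / (2 * n) with hr
  have hr0 : 0 < r := by positivity
  have hnr : n * r = 1 / 2 := by rw [hr]; field_simp
  set U : Set ℂ :=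
    {s : ℂ | (p : ℝ) + 1 < s.re} ∪ {s | -r < s.re ∧ 0 < s.im} ∪ {s | -r < s.re ∧ s.re < r}
  have hUr : ∀ s ∈ U, -r < s.re := by
    rintro s ((hs | hs) | hs)
    · have : (p : ℝ) + 1 < s.re := hs
      have : (0 : ℝ) ≤ p := p.cast_nonneg
      linarith
    · exact hs.1
    · exact hs.1
  have hU : ∀ s ∈ U, ∀ t : ℕ, 1 ≤ t → t ≤ p + 1 → (n : ℂ) * s ≠ t := by
    intro s hs t ht htp h
    have hre : n * s.re = t := by simpa using congrArg Complex.re h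
    have him : n * s.im = 0 := by simpa using congrArg Complex.im h
    have ht' : (1 : ℝ) ≤ t := by exact_mod_cast ht
    have htp' : (t : ℝ) ≤ p + 1 := by exact_mod_cast htp
    have hn1 : (1 : ℝ) ≤ n := by exact_mod_cast hn
    rcases hs with (hs | hs) | hs
    · have h1 : (p : ℝ) + 1 < s.re := hs
      nlinarith
    · have := mul_pos hn0 hs.2
      linarith
    · have := mul_lt_mul_of_pos_left hs.2 hn0
      linarith
  refine ⟨U, fun s => (0 : ℂ) ^ p * Complex.exp (-s * (Real.log (Pval n a 0) : ℂ))
      + Complex.exp (-s * (L 0 : ℂ)) * (riemannZeta (n * s + (0 : ℕ) - p)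
        + (∑ j ∈ Finset.range (p + 1), s * b j s * riemannZeta (n * s + j - p)
          + b (p + 1) s * (s * riemannZeta₀ (n * s + 1) + 1 / n)) + R s),
    ?_, isConnected_halfPlane_union hr0, ?_, ?_, ?_, ?_⟩
  · exact ((isOpen_lt continuous_const Complex.continuous_re).union
      ((isOpen_lt continuous_const Complex.continuous_re).inter
        (isOpen_lt continuous_const Complex.continuous_im))).union
      ((isOpen_lt continuous_const Complex.continuous_re).inter
        (isOpen_lt Complex.continuous_re continuous_const))
  · exact Or.inr (by simpa using hr0)
  · exact fun s hs => Or.inl (Or.inl hs)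
  · have hz : ∀ j ≤ p, DifferentiableOn ℂ (fun s => riemannZeta (n * s + j - p)) U :=
      fun j hj => differentiableOn_mul_riemannZeta_shift hU hj
    have hS : DifferentiableOn ℂ (fun s => ∑ j ∈ Finset.range (p + 1),
        s * b j s * riemannZeta (n * s + j - p)) U :=
      DifferentiableOn.fun_sum fun j hj =>
        (differentiable_id.mul (hb j)).differentiableOn.mul
          (hz j (Nat.lt_succ_iff.1 (Finset.mem_range.1 hj)))
    have hE : Differentiable ℂ fun s : ℂ => b (p + 1) s * (s * riemannZeta₀ (n * s + 1) + 1 / n) :=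
      (hb _).mul ((differentiable_id.mul
        (differentiable_riemannZeta₀.comp (by fun_prop))).add_const _)
    exact (by fun_prop : Differentiable ℂ fun s : ℂ =>
        (0 : ℂ) ^ p * Complex.exp (-s * (Real.log (Pval n a 0) : ℂ))).differentiableOn.add
      ((by fun_prop : Differentiable ℂ fun s : ℂ =>
        Complex.exp (-s * (L 0 : ℂ))).differentiableOn.mul
        (((hz 0 p.zero_le).add (hS.add hE.differentiableOn)).add (hdiff.mono hUr)))
  · intro s hs
    have hsre : (p : ℝ) + 1 < n * s.re := by
      have hn1 : (1 : ℝ) ≤ n := by exact_mod_cast hn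
      nlinarith [p.cast_nonneg (α := ℝ)]
    have hs0 : s ≠ 0 := by
      rintro rfl
      simp only [Complex.zero_re, mul_zero] at hsre
      linarith [p.cast_nonneg (α := ℝ)]
    have hzeta : ∀ j : ℕ, HasSum (fun k : ℕ => 1 / ((k : ℂ) + 1) ^ (n * s + j - p : ℂ))
        (riemannZeta (n * s + j - p)) := fun j => by
      refine hasSum_riemannZeta_nat_add_one ?_
      simp only [Complex.sub_re, Complex.add_re, Complex.mul_re, Complex.natCast_re,
        Complex.natCast_im]
      linarith [j.cast_nonneg (α := ℝ)]
    have hlast : s * b (p + 1) s * riemannZeta (n * s + (p + 1 : ℕ) - p)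
        = b (p + 1) s * (s * riemannZeta₀ (n * s + 1) + 1 / n) := by
      have hne : (n : ℂ) * s + 1 ≠ 1 := by simp [hnC, hs0]
      rw [show (n * s + (p + 1 : ℕ) - p : ℂ) = n * s + 1 by push_cast; ring,
        riemannZeta_eq_inv_sub_add hne]
      simp only [add_sub_cancel_right]
      field_simp
      ring
    beta_reduce
    rw [← hlast, ← Finset.sum_range_succ
      (fun j : ℕ => s * b j s * riemannZeta (n * s + j - p)) (p + 1)]
    have htail := (((hzeta 0).add (hasSum_sum fun j (_ : j ∈ Finset.range (p + 1 + 1)) =>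
      (hzeta j).mul_left (s * b j s))).add
        (hsum s (hUr s (Or.inl (Or.inl hs)))).hasSum).mul_left (Complex.exp (-s * (L 0 : ℂ)))
    symm
    refine HasSum.tsum_eq ?_
    rw [← hasSum_nat_add_iff' 1]
    simp only [Finset.range_one, Finset.sum_singleton, Nat.cast_zero, Nat.cast_add, Nat.cast_one,
      add_sub_cancel_left]
    simp only [Nat.cast_zero] at htail
    convert! htail using 2 with k
    rw [hlogP, natCast_add_one_pow_mul_exp n p k s _ (L 0)]
    congr 1
    have hX : ∑ j ∈ Finset.range (p + 1 + 1), s * b j s * (1 / ((k : ℂ) + 1) ^ (n * s + j - p : ℂ))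
        = 1 / ((k : ℂ) + 1) ^ (n * s - p : ℂ) *
          ∑ j ∈ Finset.range (p + 1 + 1), s * b j s * ((1 / ((k : ℝ) + 1) : ℝ) : ℂ) ^ j := by
      rw [Finset.mul_sum]
      refine Finset.sum_congr rfl fun j _ => ?_
      rw [← one_div_cpow_mul_one_div_pow]
      ring
    rw [hX, add_zero]
    simp only [hBdef]
    ring
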